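/- A minimizing curve for the null distance need not be piecewise causal (Example 5.2): In (n+1)-dimensional Minkowski space (n ≥ 1) with τ(p) = p₀, let v ∈ ℝⁿ be a unit vector, p = (0, 0) and q = (0, v). Then the curve C(s) = (0, s·v), s ∈ [0,1], satisfies d̂_τ(C(s), C(s')) = |s − s'| for all s, s', so its d̂_τ-rectifiable length equals 1 = d̂_τ(p,q); yet no two distinct points of C are causally related (for s ≠ s' neither C(s) ≼ C(s') nor C(s') ≼ C(s)). -/

import Mathlib

open scoped BigOperators

/-- A chain from `p` to `q`: a finite sequence `x 0 = p, x 1, …, x k = q` (`k ≥ 1`)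
such that consecutive points are causally related in one direction or the other. -/
def IsCausalChain {X : Type*} (R : X → X → Prop) (k : ℕ) (x : ℕ → X) (p q : X) : Prop :=
  1 ≤ k ∧ x 0 = p ∧ x k = q ∧ ∀ i < k, R (x i) (x (i + 1)) ∨ R (x (i + 1)) (x i)

/-- The null length of a chain. -/
noncomputable def nullLength {X : Type*} (τ : X → ℝ) (k : ℕ) (x : ℕ → X) : ℝ :=
  ∑ i ∈ Finset.range k, |τ (x (i + 1)) - τ (x i)|

/-- The null distance: the infimum (in `[0,∞]`, i.e. in `EReal`, of a set of
nonnegative values) of the null lengths of chains from `p` to `q`. -/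
noncomputable def nullDist {X : Type*} (R : X → X → Prop) (τ : X → ℝ) (p q : X) : EReal :=
  sInf {L : EReal | ∃ k x, IsCausalChain R k x p q ∧ L = ((nullLength τ k x : ℝ) : EReal)}

/-- Minkowski causal relation on `ℝ × ℝⁿ`: `q` is in the causal future of `p`
iff `q₀ - p₀ ≥ ‖q̄ - p̄‖`. -/
def minkCausal {n : ℕ} (p q : ℝ × EuclideanSpace ℝ (Fin n)) : Prop :=
  ‖q.2 - p.2‖ ≤ q.1 - p.1

/-- The `d̂_τ`-rectifiable length of a curve `C : [a,b] → X`: the supremum of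
`Σ d̂_τ(C(s_{i-1}), C(s_i))` over all partitions `a = s₀ ≤ … ≤ s_m = b`. -/
noncomputable def rectLengthNullDist {X : Type*} (R : X → X → Prop) (τ : X → ℝ)
    (C : ℝ → X) (a b : ℝ) : EReal :=
  sSup {L : EReal | ∃ (m : ℕ) (s : ℕ → ℝ), s 0 = a ∧ s m = b ∧ (∀ i < m, s i ≤ s (i + 1)) ∧
    L = ∑ i ∈ Finset.range m, nullDist R τ (C (s i)) (C (s (i + 1)))}

lemma ereal_coe_sum {ι : Type*} (t : Finset ι) (f : ι → ℝ) :
    ((∑ i ∈ t, f i : ℝ) : EReal) = ∑ i ∈ t, (f i : EReal) :=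
  map_sum (⟨⟨Real.toEReal, EReal.coe_zero⟩, EReal.coe_add⟩ : ℝ →+ EReal) f t

/-- The spatial displacement along a Minkowski causal chain is at most its null length. -/
lemma norm_sub_le_nullLength {n k : ℕ} {x : ℕ → ℝ × EuclideanSpace ℝ (Fin n)}
    {p q : ℝ × EuclideanSpace ℝ (Fin n)} (h : IsCausalChain minkCausal k x p q) :
    ‖q.2 - p.2‖ ≤ nullLength (fun x => x.1) k x := by
  obtain ⟨-, rfl, rfl, hc⟩ := h
  rw [← Finset.sum_range_sub (fun i => (x i).2) k]
  refine (norm_sum_le _ _).trans (Finset.sum_le_sum fun i hi => ?_)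
  rcases hc i (Finset.mem_range.1 hi) with h | h <;> unfold minkCausal at h
  · exact h.trans (le_abs_self _)
  · rw [norm_sub_rev, abs_sub_comm]
    exact h.trans (le_abs_self _)

/-- On a slice of constant time, the null distance is the Euclidean distance. -/
lemma nullDist_minkCausal_same_time {n : ℕ} (t : ℝ) (a b : EuclideanSpace ℝ (Fin n)) :
    nullDist minkCausal (fun x => x.1) (t, a) (t, b) = ((‖b - a‖ : ℝ) : EReal) := by
  apply le_antisymm
  · let m : ℝ × EuclideanSpace ℝ (Fin n) := (t + ‖b - a‖ / 2, midpoint ℝ a b)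
    have ha : minkCausal (t, a) m := by
      simp [minkCausal, m, midpoint_sub_left, norm_smul]
      linarith
    have hb : minkCausal (t, b) m := by
      simp only [minkCausal, m, midpoint_sub_right, norm_smul, norm_sub_rev a b]
      norm_num
      linarith
    refine sInf_le ⟨2, fun i => if i = 0 then (t, a) else if i = 1 then m else (t, b),
      ⟨one_le_two, rfl, rfl, fun i hi => ?_⟩, ?_⟩
    · interval_cases i
      exacts [Or.inl ha, Or.inr hb]
    · have hnonneg : 0 ≤ ‖b - a‖ / 2 := by positivity
      simp [nullLength, Finset.sum_range_succ, m, abs_of_nonneg hnonneg]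
  · refine le_sInf ?_
    rintro _ ⟨k, x, hx, rfl⟩
    have hle := norm_sub_le_nullLength hx
    exact EReal.coe_le_coe_iff.2 hle

/-- A minimizing curve for the null distance need not be piecewise causal
(Example 5.2).  In Minkowski space with `τ(p) = p₀`, for a unit vector `v`, the spacelike
segment `C(s) = (0, s·v)` satisfies `d̂_τ(C(s), C(s')) = |s − s'|`, so its
`d̂_τ`-rectifiable length equals `1 = d̂_τ((0,0), (0,v))`; yet no two distinct points of
`C` are causally related. -/
theorem minimizing_curve_not_piecewise_causal (n : ℕ) (hn : 1 ≤ n)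
    (v : EuclideanSpace ℝ (Fin n)) (hv : ‖v‖ = 1) :
    (∀ s ∈ Set.Icc (0:ℝ) 1, ∀ s' ∈ Set.Icc (0:ℝ) 1,
      nullDist minkCausal (fun x => x.1) ((0:ℝ), s • v) ((0:ℝ), s' • v)
        = ((|s' - s| : ℝ) : EReal)) ∧
    rectLengthNullDist minkCausal (fun x => x.1)
        (fun s : ℝ => ((0:ℝ), s • v)) 0 1 = ((1 : ℝ) : EReal) ∧
    nullDist minkCausal (fun x => x.1) ((0:ℝ), (0 : EuclideanSpace ℝ (Fin n)))
        ((0:ℝ), v) = ((1 : ℝ) : EReal) ∧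
    (∀ s ∈ Set.Icc (0:ℝ) 1, ∀ s' ∈ Set.Icc (0:ℝ) 1, s ≠ s' →
      ¬ minkCausal ((0:ℝ), s • v) ((0:ℝ), s' • v) ∧
      ¬ minkCausal ((0:ℝ), s' • v) ((0:ℝ), s • v)) := by
  have hdist (s s' : ℝ) : nullDist minkCausal (fun x => x.1) ((0:ℝ), s • v) ((0:ℝ), s' • v)
      = ((|s' - s| : ℝ) : EReal) := by
    rw [nullDist_minkCausal_same_time, ← sub_smul, norm_smul, hv, mul_one, Real.norm_eq_abs]
  have hnot (s s' : ℝ) (hne : s ≠ s') : ¬ minkCausal ((0:ℝ), s • v) ((0:ℝ), s' • v) := by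
    simp [minkCausal, ← sub_smul, norm_smul, hv, sub_eq_zero, hne.symm]
  refine ⟨fun s _ s' _ => hdist s s', ?_, ?_,
    fun s _ s' _ hne => ⟨hnot s s' hne, hnot s' s hne.symm⟩⟩
  · have hset : {L : EReal | ∃ (m : ℕ) (s : ℕ → ℝ), s 0 = 0 ∧ s m = 1 ∧
        (∀ i < m, s i ≤ s (i + 1)) ∧ L = ∑ i ∈ Finset.range m,
          nullDist minkCausal (fun x => x.1) ((0:ℝ), s i • v) ((0:ℝ), s (i + 1) • v)} = {1} := by
      ext L
      constructor
      · rintro ⟨m, s, h0, h1, hmono, rfl⟩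
        have hterm : ∀ i ∈ Finset.range m,
            nullDist minkCausal (fun x => x.1) ((0:ℝ), s i • v) ((0:ℝ), s (i + 1) • v)
              = ((s (i + 1) - s i : ℝ) : EReal) := fun i hi => by
          rw [hdist, abs_of_nonneg (sub_nonneg.2 (hmono i (Finset.mem_range.1 hi)))]
        rw [Finset.sum_congr rfl hterm, ← ereal_coe_sum, Finset.sum_range_sub, h0, h1]
        simp
      · rintro rfl
        exact ⟨1, fun i => i, by simp, by simp, by simp, by simp [-zero_smul, -one_smul, hdist]⟩
    unfold rectLengthNullDist
    rw [hset, sSup_singleton, EReal.coe_one]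
  · rw [nullDist_minkCausal_same_time, sub_zero, hv]
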